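/- arXiv:1502.07953 — 3 statements merged into one kernel-verified Lean document; each statement's English description precedes it below -/
import Mathlib

section
/- Let Δ be a negative integer with Δ ≡ 0 or 1 (mod 4), and set n = −Δ/4 if Δ ≡ 0 (mod 4) and n = −Δ if Δ ≡ 1 (mod 4). Then h(Δ) = F̃(n) when Δ ≡ 0, 1, or 4 (mod 8) or Δ = −3, and h(Δ) = F̃(n)/3 when Δ ≡ 5 (mod 8) and Δ ≠ −3. -/
open scoped Classical

/-- A classical binary quadratic form `(a, 2b, c)`, i.e. `a x² + 2 b x y + c y²`,
stored as the triple `(a, b, c)` of integers. -/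
structure ClassicalForm where
  a : ℤ
  b : ℤ
  c : ℤ

namespace ClassicalForm

/-- The value `a x² + 2 b x y + c y²` of the form at `(x, y)`. -/
def eval (f : ClassicalForm) (x y : ℤ) : ℤ :=
  f.a * x ^ 2 + 2 * f.b * x * y + f.c * y ^ 2

/-- The determinant `D = b² - a c` of the form `(a, 2b, c)`. -/
def det (f : ClassicalForm) : ℤ := f.b ^ 2 - f.a * f.c

/-- Positive definite: negative determinant and `a > 0`. -/
def PosDef (f : ClassicalForm) : Prop := f.det < 0 ∧ 0 < f.a

/-- The divisor `δ = gcd(a, b, c)` of the form `(a, 2b, c)`. -/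
def divisor (f : ClassicalForm) : ℕ := Int.gcd (Int.gcd f.a f.b) f.c

/-- Primitive: divisor `gcd(a, b, c) = 1`. -/
def Primitive (f : ClassicalForm) : Prop := f.divisor = 1

/-- A form of divisor `δ` is *uneven* if its primitive part `(a/δ, 2b/δ, c/δ)`
satisfies `gcd(a/δ, 2b/δ, c/δ) = 1` (i.e. `a/δ`, `c/δ` are not both even);
equivalently, `gcd(a, 2b, c) = gcd(a, b, c)`. -/
def Uneven (f : ClassicalForm) : Prop :=
  Int.gcd (Int.gcd f.a (2 * f.b)) f.c = f.divisor

/-- A form of divisor `δ` is *even* if its primitive part `(a/δ, 2b/δ, c/δ)`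
has both outer coefficients even; equivalently `gcd(a, 2b, c) = 2 gcd(a, b, c)`. -/
def EvenForm (f : ClassicalForm) : Prop :=
  Int.gcd (Int.gcd f.a (2 * f.b)) f.c = 2 * f.divisor

/-- Proper equivalence: `g` is obtained from `f` by a change of variables of
determinant `1` (i.e. with matrix in `SL₂(ℤ)`). -/
def Equiv (f g : ClassicalForm) : Prop :=
  ∃ p q r s : ℤ, p * s - q * r = 1 ∧
    ∀ x y : ℤ, g.eval x y = f.eval (p * x + q * y) (r * x + s * y)

end ClassicalForm

/-- The number of proper equivalence classes of forms in a set `S` of classical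
forms (the sets used below are closed under proper equivalence). -/
noncomputable def classCount (S : Set ClassicalForm) : ℕ :=
  Nat.card (Quot (fun f g : S => ClassicalForm.Equiv f.1 g.1))

/-- `F n`: the number of proper equivalence classes of positive definite uneven
forms (primitive or derived) of determinant `-n`. -/
noncomputable def F (n : ℕ) : ℕ :=
  classCount {f | f.det = -(n : ℤ) ∧ f.PosDef ∧ f.Uneven}

/-- `F₁ n`: the number of proper equivalence classes of positive definite even
forms (primitive or derived) of determinant `-n`. -/
noncomputable def F₁ (n : ℕ) : ℕ :=
  classCount {f | f.det = -(n : ℤ) ∧ f.PosDef ∧ f.EvenForm}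

/-- `F̃ n`: the number of proper equivalence classes of positive definite
primitive uneven forms of determinant `-n`. -/
noncomputable def Ftil (n : ℕ) : ℕ :=
  classCount {f | f.det = -(n : ℤ) ∧ f.PosDef ∧ f.Primitive ∧ f.Uneven}

/-- `F̃₁ n`: the number of proper equivalence classes of positive definite
primitive even forms of determinant `-n`. -/
noncomputable def Ftil₁ (n : ℕ) : ℕ :=
  classCount {f | f.det = -(n : ℤ) ∧ f.PosDef ∧ f.Primitive ∧ f.EvenForm}

/-- The weighted count `F(n)`: every class counts `1`, except that the class of
`(t, 0, t)` (of determinant `-t²`) counts `1/2`. -/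
noncomputable def Fw (n : ℕ) : ℚ :=
  (F n : ℚ) - if ∃ t : ℕ, 0 < t ∧ n = t ^ 2 then 1 / 2 else 0

/-- The weighted count `F₁(n)`: every class counts `1`, except that the class of
`(2t, 2t, 2t)` (of determinant `-3t²`) counts `1/3`. -/
noncomputable def F₁w (n : ℕ) : ℚ :=
  (F₁ n : ℚ) - if ∃ t : ℕ, 0 < t ∧ n = 3 * t ^ 2 then 2 / 3 else 0

/-- A modern binary quadratic form `a x² + b x y + c y²`. -/
structure ModernForm where
  a : ℤ
  b : ℤ
  c : ℤ

namespace ModernForm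

/-- The value `a x² + b x y + c y²` of the form at `(x, y)`. -/
def eval (f : ModernForm) (x y : ℤ) : ℤ :=
  f.a * x ^ 2 + f.b * x * y + f.c * y ^ 2

/-- The discriminant `Δ = b² - 4 a c`. -/
def disc (f : ModernForm) : ℤ := f.b ^ 2 - 4 * f.a * f.c

/-- Positive definite: negative discriminant and `a > 0`. -/
def PosDef (f : ModernForm) : Prop := f.disc < 0 ∧ 0 < f.a

/-- Primitive: `gcd(a, b, c) = 1`. -/
def Primitive (f : ModernForm) : Prop := Int.gcd (Int.gcd f.a f.b) f.c = 1

/-- `SL₂(ℤ)`-equivalence of modern forms. -/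
def Equiv (f g : ModernForm) : Prop :=
  ∃ p q r s : ℤ, p * s - q * r = 1 ∧
    ∀ x y : ℤ, g.eval x y = f.eval (p * x + q * y) (r * x + s * y)

end ModernForm

/-- The class number `h(Δ)`: the number of `SL₂(ℤ)`-equivalence classes of
primitive positive definite modern forms of discriminant `Δ`. -/
noncomputable def h (Δ : ℤ) : ℕ :=
  Nat.card (Quot (fun f g : {f : ModernForm // f.disc = Δ ∧ f.PosDef ∧ f.Primitive} =>
    ModernForm.Equiv f.1 g.1))

/-- `h_ω(Δ)`: equal to `h(Δ)` except `h_ω(-3) = 1/3` and `h_ω(-4) = 1/2`. -/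
noncomputable def hω (Δ : ℤ) : ℚ :=
  if Δ = -3 then 1 / 3 else if Δ = -4 then 1 / 2 else (h Δ : ℚ)

/-- The Hurwitz class number `H(n) = Σ_{t | f} h_ω(Δ/t²)`, where `Δ = -n = f² Δ₁`
with `Δ₁` a fundamental discriminant; equivalently, the sum of `h_ω(-(n/t²))`
over all `t ≥ 1` with `t² ∣ n` and `-(n/t²) ≡ 0` or `1 (mod 4)`. -/
noncomputable def Hur (n : ℕ) : ℚ :=
  ∑ t ∈ (Finset.Icc 1 n).filter (fun t =>
      t ^ 2 ∣ n ∧ ((-((n / t ^ 2 : ℕ) : ℤ)) % 4 = 0 ∨ (-((n / t ^ 2 : ℕ) : ℤ)) % 4 = 1)),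
    hω (-((n / t ^ 2 : ℕ) : ℤ))

open Matrix.SpecialLinearGroup CongruenceSubgroup

open scoped MatrixGroups

namespace ModernForm

@[ext]
theorem eq_of_coeffs {f g : ModernForm} (ha : f.a = g.a) (hb : f.b = g.b) (hc : f.c = g.c) : f = g := by
  cases f; cases g; simp_all

/-- Forms with the same values have the same coefficients. -/
theorem eq_of_eval_eq {f g : ModernForm} (h : ∀ x y, f.eval x y = g.eval x y) : f = g := by
  have h₁ := h 1 0
  have h₂ := h 0 1
  have h₃ := h 1 1
  simp only [eval] at h₁ h₂ h₃
  ext <;> linarith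

/-- The right action of `SL₂(ℤ)` on forms by linear change of variables. -/
def act (f : ModernForm) (M : SL(2, ℤ)) : ModernForm where
  a := f.a * M 0 0 ^ 2 + f.b * M 0 0 * M 1 0 + f.c * M 1 0 ^ 2
  b := 2 * f.a * M 0 0 * M 0 1 + f.b * (M 0 0 * M 1 1 + M 0 1 * M 1 0) + 2 * f.c * M 1 0 * M 1 1
  c := f.a * M 0 1 ^ 2 + f.b * M 0 1 * M 1 1 + f.c * M 1 1 ^ 2

theorem eval_act (f : ModernForm) (M : SL(2, ℤ)) (x y : ℤ) :
    (f.act M).eval x y = f.eval (M 0 0 * x + M 0 1 * y) (M 1 0 * x + M 1 1 * y) := by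
  simp only [eval, act]; ring

theorem act_one (f : ModernForm) : f.act 1 = f := by
  ext <;> simp [act]

theorem act_mul (f : ModernForm) (M N : SL(2, ℤ)) : f.act (M * N) = (f.act M).act N := by
  ext <;> simp [act, Matrix.mul_apply, Fin.sum_univ_two] <;> ring

theorem det_entries (M : SL(2, ℤ)) : M 0 0 * M 1 1 - M 0 1 * M 1 0 = 1 := by
  rw [← Matrix.det_fin_two, M.det_coe]

/-- The element of `SL₂(ℤ)` with the given entries. -/
def mkSL (p q r s : ℤ) (h : p * s - q * r = 1) : SL(2, ℤ) :=
  ⟨!![p, q; r, s], by rw [Matrix.det_fin_two_of, h]⟩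

@[simp] theorem mkSL_00 (p q r s : ℤ) (h) : mkSL p q r s h 0 0 = p := rfl
@[simp] theorem mkSL_01 (p q r s : ℤ) (h) : mkSL p q r s h 0 1 = q := rfl
@[simp] theorem mkSL_10 (p q r s : ℤ) (h) : mkSL p q r s h 1 0 = r := rfl
@[simp] theorem mkSL_11 (p q r s : ℤ) (h) : mkSL p q r s h 1 1 = s := rfl

theorem disc_act (f : ModernForm) (M : SL(2, ℤ)) : (f.act M).disc = f.disc := by
  have h := det_entries M
  have : (f.act M).disc = f.disc * (M 0 0 * M 1 1 - M 0 1 * M 1 0) ^ 2 := by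
    simp only [disc, act]; ring
  rw [this, h]; ring

theorem eval_pos {f : ModernForm} (hf : f.PosDef) {x y : ℤ} (hxy : x ≠ 0 ∨ y ≠ 0) :
    0 < f.eval x y := by
  obtain ⟨hd, ha⟩ := hf
  have key : 4 * f.a * f.eval x y = (2 * f.a * x + f.b * y) ^ 2 + (-f.disc) * y ^ 2 := by
    simp only [eval, disc]; ring
  have hpos : 0 < (2 * f.a * x + f.b * y) ^ 2 + (-f.disc) * y ^ 2 := by
    by_cases hy : y = 0
    · subst hy
      have hx : x ≠ 0 := by simpa using hxy
      have : 2 * f.a * x ≠ 0 := by positivity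
      simp only [mul_zero, add_zero, ne_eq, OfNat.ofNat_ne_zero, not_false_eq_true, zero_pow]
      positivity
    · have h₁ : 0 < -f.disc := by linarith
      positivity
  rw [← key] at hpos
  exact pos_of_mul_pos_right hpos (by positivity)

theorem PosDef.act {f : ModernForm} (hf : f.PosDef) (M : SL(2, ℤ)) : (f.act M).PosDef := by
  refine ⟨by rw [disc_act]; exact hf.1, ?_⟩
  refine eval_pos hf (x := M 0 0) (y := M 1 0) ?_
  by_contra! h
  have := det_entries M
  simp [h.1, h.2] at this

theorem primitive_iff_forall_dvd (f : ModernForm) :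
    f.Primitive ↔ ∀ d : ℤ, d ∣ f.a → d ∣ f.b → d ∣ f.c → d ∣ 1 := by
  unfold Primitive
  constructor
  · intro h d ha hb hc
    have := Int.dvd_coe_gcd (Int.dvd_coe_gcd ha hb) hc
    rwa [h] at this
  · intro h
    have h₁ := h (Int.gcd (Int.gcd f.a f.b) f.c)
      ((Int.gcd_dvd_left ..).trans (Int.gcd_dvd_left ..))
      ((Int.gcd_dvd_left ..).trans (Int.gcd_dvd_right ..)) (Int.gcd_dvd_right ..)
    exact Nat.dvd_one.mp (by exact_mod_cast h₁)

theorem Primitive.exists_combination {f : ModernForm} (hf : f.Primitive) :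
    ∃ x y z : ℤ, x * f.a + y * f.b + z * f.c = 1 := by
  unfold Primitive at hf
  have h₁ := Int.gcd_eq_gcd_ab (Int.gcd f.a f.b) f.c
  have h₂ := Int.gcd_eq_gcd_ab f.a f.b
  rw [hf, Nat.cast_one] at h₁
  set α := Int.gcdA (Int.gcd f.a f.b) f.c
  exact ⟨Int.gcdA f.a f.b * α, Int.gcdB f.a f.b * α, Int.gcdB (Int.gcd f.a f.b) f.c,
    by linear_combination -α * h₂ - h₁⟩

theorem Primitive.of_act {f : ModernForm} {M : SL(2, ℤ)} (hf : (f.act M).Primitive) :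
    f.Primitive := by
  rw [primitive_iff_forall_dvd] at hf ⊢
  rintro d ⟨a, ha⟩ ⟨b, hb⟩ ⟨c, hc⟩
  refine hf d ?_ ?_ ?_ <;> simp only [ModernForm.act, ha, hb, hc]
  · exact ⟨a * M 0 0 ^ 2 + b * M 0 0 * M 1 0 + c * M 1 0 ^ 2, by ring⟩
  · exact ⟨2 * a * M 0 0 * M 0 1 + b * (M 0 0 * M 1 1 + M 0 1 * M 1 0)
      + 2 * c * M 1 0 * M 1 1, by ring⟩
  · exact ⟨a * M 0 1 ^ 2 + b * M 0 1 * M 1 1 + c * M 1 1 ^ 2, by ring⟩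

theorem Primitive.act {f : ModernForm} (hf : f.Primitive) (M : SL(2, ℤ)) :
    (f.act M).Primitive := by
  refine Primitive.of_act (M := M⁻¹) ?_
  rwa [← act_mul, mul_inv_cancel, act_one]

/-- The primitive positive definite forms of discriminant `Δ`. -/
abbrev Admissible (Δ : ℤ) (f : ModernForm) : Prop := f.disc = Δ ∧ f.PosDef ∧ f.Primitive

theorem Admissible.act {Δ : ℤ} {f : ModernForm} (hf : Admissible Δ f) (M : SL(2, ℤ)) :
    Admissible Δ (f.act M) :=
  ⟨(disc_act f M).trans hf.1, hf.2.1.act M, hf.2.2.act M⟩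

/-- Equivalence of the forms with property `P` under the subgroup `Γ` of `SL₂(ℤ)`. -/
def orbitSetoid (Γ : Subgroup SL(2, ℤ)) (P : ModernForm → Prop) : Setoid {f // P f} where
  r f g := ∃ M ∈ Γ, g.1 = f.1.act M
  iseqv :=
    { refl f := ⟨1, Γ.one_mem, (act_one _).symm⟩
      symm := by
        rintro f g ⟨M, hM, e⟩
        exact ⟨M⁻¹, Γ.inv_mem hM, by rw [e, ← act_mul, mul_inv_cancel, act_one]⟩
      trans := by
        rintro f g k ⟨M, hM, e⟩ ⟨N, hN, e'⟩
        exact ⟨M * N, Γ.mul_mem hM hN, by rw [e', e, act_mul]⟩ }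

/-- The classes of forms with property `P` under the subgroup `Γ` of `SL₂(ℤ)`. -/
abbrev Classes (Γ : Subgroup SL(2, ℤ)) (P : ModernForm → Prop) : Type :=
  Quotient (orbitSetoid Γ P)

theorem equiv_iff_exists_act (f g : ModernForm) : f.Equiv g ↔ ∃ M : SL(2, ℤ), g = f.act M := by
  constructor
  · rintro ⟨p, q, r, s, hdet, e⟩
    exact ⟨mkSL p q r s hdet, eq_of_eval_eq fun x y => by rw [e, eval_act]; simp⟩
  · rintro ⟨M, rfl⟩
    exact ⟨_, _, _, _, det_entries M, eval_act f M⟩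

theorem h_eq_card_classes (Δ : ℤ) : h Δ = Nat.card (Classes ⊤ (Admissible Δ)) :=
  Nat.card_congr <| Quot.congrRight fun f g =>
    (equiv_iff_exists_act f.1 g.1).trans
      (exists_congr fun _ => (and_iff_right (Subgroup.mem_top _)).symm)

theorem mem_Gamma0_two_iff (M : SL(2, ℤ)) : M ∈ Gamma0 2 ↔ 2 ∣ M 1 0 := by
  rw [Gamma0_mem]
  exact_mod_cast ZMod.intCast_zmod_eq_zero_iff_dvd (M 1 0) 2

/-- The form `f(x, 2y)`. -/
def stretch (f : ModernForm) : ModernForm := ⟨f.a, 2 * f.b, 4 * f.c⟩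

/-- The admissible forms with odd leading coefficient. -/
abbrev OddAdmissible (Δ : ℤ) (f : ModernForm) : Prop := Admissible Δ f ∧ f.a % 2 = 1

theorem OddAdmissible.stretch {Δ : ℤ} {f : ModernForm} (hf : OddAdmissible Δ f) :
    Admissible (4 * Δ) f.stretch := by
  obtain ⟨⟨hd, hpos, hprim⟩, hodd⟩ := hf
  have hd' : f.stretch.disc = 4 * f.disc := by simp only [disc, ModernForm.stretch]; ring
  refine ⟨by rw [hd', hd], ⟨by rw [hd']; linarith [hpos.1], hpos.2⟩, ?_⟩
  rw [primitive_iff_forall_dvd] at hprim ⊢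
  intro d ha hb hc
  have hcop : IsCoprime d 2 := by
    refine IsCoprime.of_isCoprime_of_dvd_left ?_ ha
    exact ⟨1, -(f.a / 2), by simp only [ModernForm.stretch]; omega⟩
  refine hprim d ha (hcop.dvd_of_dvd_mul_left hb) ?_
  have h₄ : d ∣ 2 * (2 * f.c) := by
    rw [← mul_assoc]; exact hc
  exact hcop.dvd_of_dvd_mul_left (hcop.dvd_of_dvd_mul_left h₄)

theorem stretch_act (f : ModernForm) (p q r s : ℤ) (h : p * s - q * (2 * r) = 1) :
    (f.act (mkSL p q (2 * r) s h)).stretch =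
      f.stretch.act (mkSL p (2 * q) r s (by linarith)) := by
  ext <;> simp [stretch, act] <;> ring

theorem stretch_injective : Function.Injective stretch := by
  intro f g e
  simp only [stretch, mk.injEq] at e
  ext <;> omega

theorem act_eq_of_stretch_eq {f g : ModernForm} (hf : f.a % 2 = 1) {M : SL(2, ℤ)}
    (e : g.stretch = f.stretch.act M) : ∃ N ∈ Gamma0 2, g = f.act N := by
  have hdet := det_entries M
  have hc : 4 * g.c = f.a * M 0 1 ^ 2 + 2 * f.b * M 0 1 * M 1 1 + 4 * f.c * M 1 1 ^ 2 :=
    congrArg c e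
  have hq : Even (M 0 1) := by
    have : Even (f.a * M 0 1 ^ 2) :=
      ⟨2 * g.c - f.b * M 0 1 * M 1 1 - 2 * f.c * M 1 1 ^ 2, by linarith⟩
    rcases Int.even_mul.mp this with h | h
    · exact absurd h (by rwa [Int.not_even_iff])
    · exact (Int.even_pow.mp h).1
  obtain ⟨q, hq⟩ := hq.two_dvd
  have hdet' : M 0 0 * M 1 1 - q * (2 * M 1 0) = 1 := by rw [hq] at hdet; linarith
  refine ⟨mkSL (M 0 0) q (2 * M 1 0) (M 1 1) hdet', ?_, stretch_injective ?_⟩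
  · rw [mem_Gamma0_two_iff]; simp
  · rw [e, stretch_act]
    ext <;> simp [act, hq]

theorem Admissible.exists_act_odd {Δ : ℤ} {f : ModernForm} (hf : Admissible Δ f) :
    ∃ M : SL(2, ℤ), (f.act M).a % 2 = 1 := by
  by_contra! hM
  have h₁ := hM 1
  have h₂ := hM (mkSL 0 (-1) 1 0 (by norm_num))
  have h₃ := hM (mkSL 1 0 1 1 (by norm_num))
  simp [ModernForm.act] at h₁ h₂ h₃
  have := (primitive_iff_forall_dvd f).mp hf.2.2 2 (by omega) (by omega) (by omega)
  omega

theorem Admissible.exists_stretch_eq_act {Δ : ℤ} (hΔ : Δ % 4 = 1) {f : ModernForm}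
    (hf : Admissible (4 * Δ) f) :
    ∃ g, OddAdmissible Δ g ∧ ∃ M : SL(2, ℤ), g.stretch = f.act M := by
  obtain ⟨M, hM⟩ := hf.exists_act_odd
  have hbeven (k : ModernForm) (hk : Admissible (4 * Δ) k) : 2 ∣ k.b := by
    have h₁ : k.b ^ 2 - 4 * k.a * k.c = 4 * Δ := hk.1
    have : 2 ∣ k.b ^ 2 := ⟨2 * Δ + 2 * k.a * k.c, by linarith⟩
    exact Int.prime_two.dvd_of_dvd_pow this
  obtain ⟨N, hN, b, hb, hbodd⟩ : ∃ N : SL(2, ℤ), (f.act N).a % 2 = 1 ∧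
      ∃ b, (f.act N).b = 2 * b ∧ b % 2 = 1 := by
    obtain ⟨b, hb⟩ := hbeven _ (hf.act M)
    rcases Int.emod_two_eq_zero_or_one b with h | h
    · refine ⟨M * mkSL 1 1 0 1 (by norm_num), ?_, (f.act M).a + b, ?_, by omega⟩
      · rw [act_mul]; simpa [ModernForm.act] using hM
      · rw [act_mul]
        generalize f.act M = k at *
        simp [ModernForm.act, hb]; ring
    · exact ⟨M, hM, b, hb, h⟩
  have hk := hf.act N
  revert hN hb hk
  generalize hkN : f.act N = k
  intro ha hb hk
  obtain ⟨hd, hpos, hprim⟩ := hk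
  have hd₁ : k.b ^ 2 - 4 * k.a * k.c = 4 * Δ := hd
  have hac : k.a * k.c = b ^ 2 - Δ := by rw [hb] at hd₁; linarith
  have h4 : (4 : ℤ) ∣ k.c := by
    have h₁ : (4 : ℤ) ∣ k.a * k.c := by
      rw [hac]
      have := Int.sq_mod_four_eq_one_of_odd (Int.odd_iff.mpr hbodd)
      omega
    have hcop : IsCoprime (2 : ℤ) k.a := ⟨-(k.a / 2), 1, by omega⟩
    have : IsCoprime ((2 : ℤ) ^ 2) k.a := hcop.pow_left
    exact IsCoprime.dvd_of_dvd_mul_left (by norm_num at this; exact this) h₁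
  obtain ⟨c, hc⟩ := h4
  have hdisc : (⟨k.a, b, c⟩ : ModernForm).disc = Δ := by
    simp only [disc]; rw [hc] at hac; linarith
  refine ⟨⟨k.a, b, c⟩, ⟨⟨hdisc, ⟨?_, hpos.2⟩, ?_⟩, ha⟩, N, ?_⟩
  · rw [hdisc]; linarith [hpos.1]
  · rw [primitive_iff_forall_dvd] at hprim ⊢
    intro d hda hdb hdc
    exact hprim d hda (hb ▸ hdb.mul_left 2) (hc ▸ hdc.mul_left 4)
  · rw [hkN]; ext <;> simp [stretch, hb, hc]

theorem card_classes_four_mul {Δ : ℤ} (hΔ : Δ % 4 = 1) :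
    Nat.card (Classes (Gamma0 2) (OddAdmissible Δ)) =
      Nat.card (Classes ⊤ (Admissible (4 * Δ))) := by
  let φ : Classes (Gamma0 2) (OddAdmissible Δ) → Classes ⊤ (Admissible (4 * Δ)) :=
    Quotient.map (fun f => ⟨f.1.stretch, f.2.stretch⟩) <| by
      rintro f g ⟨M, hM, e⟩
      obtain ⟨r, hr⟩ := (mem_Gamma0_two_iff M).mp hM
      have hdet := det_entries M
      rw [hr] at hdet
      refine ⟨_, trivial, Eq.trans ?_ (stretch_act f.1 _ _ _ _ hdet)⟩
      refine congrArg stretch (e.trans ?_)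
      ext <;> simp [act, hr]
  refine Nat.card_congr (_root_.Equiv.ofBijective φ ⟨?_, ?_⟩)
  · rintro ⟨f⟩ ⟨g⟩ e
    obtain ⟨M, -, e⟩ := Quotient.exact e
    exact Quotient.sound (act_eq_of_stretch_eq f.2.2 e)
  · rintro ⟨f⟩
    obtain ⟨g, hg, M, e⟩ := f.2.exists_stretch_eq_act hΔ
    exact ⟨⟦⟨g, hg⟩⟧, (Quotient.sound ⟨M, trivial, e⟩ :
      (⟦f⟧ : Classes ⊤ (Admissible (4 * Δ))) = ⟦⟨g.stretch, hg.stretch⟩⟧).symm⟩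

/-- If `SL₂(ℤ)`-equivalent forms with odd leading coefficient are always `Γ₀(2)`-equivalent,
then the two kinds of classes are in bijection. -/
theorem card_classes_Gamma0_eq {Δ : ℤ}
    (H : ∀ f g : ModernForm, OddAdmissible Δ f → OddAdmissible Δ g →
      ∀ M : SL(2, ℤ), g = f.act M → ∃ N ∈ Gamma0 2, g = f.act N) :
    Nat.card (Classes (Gamma0 2) (OddAdmissible Δ)) = Nat.card (Classes ⊤ (Admissible Δ)) := by
  let φ : Classes (Gamma0 2) (OddAdmissible Δ) → Classes ⊤ (Admissible Δ) :=
    Quotient.map (fun f => ⟨f.1, f.2.1⟩) <| by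
      rintro f g ⟨M, -, e⟩
      exact ⟨M, trivial, e⟩
  refine Nat.card_congr (_root_.Equiv.ofBijective φ ⟨?_, ?_⟩)
  · rintro ⟨f⟩ ⟨g⟩ e
    obtain ⟨M, -, e⟩ := Quotient.exact e
    exact Quotient.sound (H _ _ f.2 g.2 M e)
  · rintro ⟨f⟩
    obtain ⟨M, hM⟩ := f.2.exists_act_odd
    exact ⟨⟦⟨f.1.act M, f.2.act M, hM⟩⟧, (Quotient.sound ⟨M, trivial, rfl⟩ :
      (⟦f⟧ : Classes ⊤ (Admissible Δ)) = ⟦⟨f.1.act M, f.2.act M⟩⟧).symm⟩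

theorem b_odd {Δ : ℤ} (hΔ : Δ % 4 = 1) {f : ModernForm} (hf : f.disc = Δ) : f.b % 2 = 1 := by
  have h₁ : f.b ^ 2 - 4 * f.a * f.c = Δ := hf
  rw [← Int.odd_iff]
  by_contra h
  rw [Int.not_odd_iff_even] at h
  obtain ⟨b, hb⟩ := h
  have : Δ = 4 * (b ^ 2 - f.a * f.c) := by rw [← h₁, hb]; ring
  omega

theorem four_mul_ac_emod_eight {Δ : ℤ} (hΔ : Δ % 4 = 1) {f : ModernForm} (hf : f.disc = Δ) :
    (4 * (f.a * f.c)) % 8 = (1 - Δ) % 8 := by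
  have h₁ : f.b ^ 2 - 4 * f.a * f.c = Δ := hf
  have h₂ := Int.eight_dvd_sq_sub_one_of_odd (Int.odd_iff.mpr (b_odd hΔ hf))
  have h₃ : 4 * (f.a * f.c) = f.b ^ 2 - Δ := by linarith
  omega

theorem even_c_of_emod_eight {Δ : ℤ} (hΔ : Δ % 8 = 1) {f : ModernForm} (hf : f.disc = Δ)
    (ha : f.a % 2 = 1) : f.c % 2 = 0 := by
  have h₁ := four_mul_ac_emod_eight (by omega) hf
  have h₂ : Even (f.a * f.c) := by rw [Int.even_iff]; omega
  rcases Int.even_mul.mp h₂ with h | h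
  · rw [Int.even_iff] at h; omega
  · exact Int.even_iff.mp h

theorem odd_ac_of_emod_eight {Δ : ℤ} (hΔ : Δ % 8 = 5) {f : ModernForm} (hf : f.disc = Δ) :
    f.a % 2 = 1 ∧ f.c % 2 = 1 := by
  have h₁ := four_mul_ac_emod_eight (by omega) hf
  have h₂ : Odd (f.a * f.c) := by rw [Int.odd_iff]; omega
  simpa [Int.odd_iff] using Int.odd_mul.mp h₂

theorem mem_Gamma0_of_act_odd {Δ : ℤ} (hΔ : Δ % 8 = 1) {f : ModernForm} (hf : f.disc = Δ)
    (ha : f.a % 2 = 1) {M : SL(2, ℤ)} (hM : (f.act M).a % 2 = 1) : M ∈ Gamma0 2 := by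
  have hc := even_c_of_emod_eight hΔ hf ha
  have hb := b_odd (by omega) hf
  rw [mem_Gamma0_two_iff, ← even_iff_two_dvd]
  have h₁ : Odd (f.a * M 0 0 ^ 2 + f.b * M 0 0 * M 1 0 + f.c * M 1 0 ^ 2) := Int.odd_iff.mpr hM
  by_contra hr
  rw [← Int.even_iff] at hc
  rw [← Int.odd_iff, ← Int.not_even_iff_odd] at ha hb
  rw [← Int.not_even_iff_odd] at h₁
  apply h₁
  simp only [Int.even_add, Int.even_mul, Int.even_pow]
  tauto

theorem exists_Gamma0_act_of_disc_neg_three {f : ModernForm} (hf : f.disc = -3)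
    (M : SL(2, ℤ)) : ∃ N ∈ Gamma0 2, f.act M = f.act N := by
  obtain ⟨ha, hc⟩ := odd_ac_of_emod_eight (by norm_num) hf
  have hb := b_odd (by norm_num) hf
  obtain ⟨k, hk⟩ : ∃ k, f.b = 2 * k + 1 := ⟨f.b / 2, by omega⟩
  have hd : f.b ^ 2 - 4 * f.a * f.c = -3 := hf
  have hac : f.a * f.c = k ^ 2 + k + 1 := by rw [hk] at hd; linarith
  have hT : -k * (k + 1) - -f.c * f.a = 1 := by linarith
  set T := mkSL (-k) (-f.c) f.a (k + 1) hT with hTdef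
  have hfix : f.act T = f := by
    ext <;> simp only [act, hTdef, mkSL_00, mkSL_01, mkSL_10, mkSL_11, hk]
    · linear_combination f.a * hac
    · linear_combination (2 * k + 1) * hac
    · linear_combination f.c * hac
  have hfix' : f.act T⁻¹ = f := by
    conv_lhs => rw [← hfix]
    rw [← act_mul, mul_inv_cancel, act_one]
  have h₁ : (T * M) 1 0 = f.a * M 0 0 + (k + 1) * M 1 0 := by
    simp [Matrix.mul_apply, Fin.sum_univ_two, hTdef]
  have h₂ : (T⁻¹ * M) 1 0 = -f.a * M 0 0 + -k * M 1 0 := by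
    simp [Matrix.mul_apply, Fin.sum_univ_two, hTdef, Matrix.adjugate_fin_two]
  by_cases h : 2 ∣ M 1 0
  · exact ⟨M, (mem_Gamma0_two_iff M).mpr h, rfl⟩
  by_cases h' : 2 ∣ (T * M) 1 0
  · exact ⟨T * M, (mem_Gamma0_two_iff _).mpr h', by rw [act_mul, hfix]⟩
  refine ⟨T⁻¹ * M, (mem_Gamma0_two_iff _).mpr ?_, by rw [act_mul, hfix']⟩
  rw [h₁, ← even_iff_two_dvd] at h'
  rw [h₂, ← even_iff_two_dvd]
  rw [← even_iff_two_dvd] at h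
  rw [← Int.odd_iff, ← Int.not_even_iff_odd] at ha
  simp only [Int.even_add, Int.even_mul, even_neg, Int.not_even_one, iff_false] at h' ⊢
  tauto

/-- Only `±1` fixes a form of discriminant less than `-4`. -/
theorem eq_one_or_neg_one_of_act_eq {Δ : ℤ} (hΔ : Δ < -4) {f : ModernForm}
    (hf : Admissible Δ f) {M : SL(2, ℤ)} (hM : f.act M = f) : M = 1 ∨ M = -1 := by
  obtain ⟨hd, hpos, hprim⟩ := hf
  have ha : f.a ≠ 0 := hpos.2.ne'
  have hdet := det_entries M
  have h₁ := congrArg a hM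
  have h₂ := congrArg b hM
  have h₃ := congrArg c hM
  simp only [act] at h₁ h₂ h₃
  have hd' : f.b ^ 2 - 4 * f.a * f.c = Δ := hd
  obtain ⟨x, y, z, hxyz⟩ := hprim.exists_combination
  generalize hp : M 0 0 = p at *
  generalize hq : M 0 1 = q at *
  generalize hr : M 1 0 = r at *
  generalize hs : M 1 1 = s at *
  have e₁ : f.a * (s - p) = f.b * r := by
    have : 2 * (f.a * (s - p)) = 2 * (f.b * r) := by
      linear_combination (-2 * s) * h₁ + r * h₂ + (2 * f.a * p + f.b * r) * hdet
    linarith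
  have e₂ : f.a * q = -f.c * r := by
    have : 2 * (f.a * q) = 2 * (-f.c * r) := by
      linear_combination s * h₂ - 2 * r * h₃ - (2 * f.a * q + f.b * s) * hdet
    linarith
  obtain ⟨u, hu⟩ : ∃ u, r = f.a * u :=
    ⟨x * r + y * (s - p) - z * q, by linear_combination -r * hxyz - y * e₁ + z * e₂⟩
  have hqu : q = -f.c * u := mul_left_cancel₀ ha (by rw [e₂, hu]; ring)
  have hsu : s - p = f.b * u := mul_left_cancel₀ ha (by rw [e₁, hu]; ring)
  have key : (p + s) ^ 2 = 4 + u ^ 2 * Δ := by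
    linear_combination (s - p + f.b * u) * hsu + 4 * hdet + 4 * r * hqu - 4 * f.c * u * hu
      + u ^ 2 * hd'
  have hu0 : u = 0 := by
    by_contra h0
    have : 0 < u ^ 2 := by positivity
    nlinarith [sq_nonneg (p + s)]
  subst hu0
  have hr0 : r = 0 := by simpa using hu
  have hq0 : q = 0 := by simpa using hqu
  have hsp : s = p := by linarith
  have hpp : p * p = 1 := by rw [hr0, hsp] at hdet; linarith
  rcases mul_self_eq_one_iff.mp hpp with h | h
  · left; ext i j; fin_cases i <;> fin_cases j <;> simp [*]
  · right; ext i j; fin_cases i <;> fin_cases j <;> simp [*]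

/-- Representatives for the left cosets of `Γ₀(2)` in `SL₂(ℤ)`. -/
def cosetRep : Fin 3 → SL(2, ℤ) :=
  ![1, mkSL 0 (-1) 1 0 (by norm_num), mkSL 1 0 1 1 (by norm_num)]

theorem exists_cosetRep_mul (M : SL(2, ℤ)) : ∃ i, ∃ N ∈ Gamma0 2, M = cosetRep i * N := by
  suffices ∃ i, 2 ∣ ((cosetRep i)⁻¹ * M) 1 0 by
    obtain ⟨i, hi⟩ := this
    exact ⟨i, _, (mem_Gamma0_two_iff _).mpr hi, by group⟩
  by_contra! H
  have h₀ := H 0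
  have h₁ := H 1
  have h₂ := H 2
  simp [cosetRep, Matrix.mul_apply, Fin.sum_univ_two, Matrix.adjugate_fin_two] at h₀ h₁ h₂
  omega

theorem cosetRep_eq_of_mul {i j : Fin 3} {N : SL(2, ℤ)} (hN : N ∈ Gamma0 2)
    (h : cosetRep i * N = cosetRep j ∨ cosetRep i * N = -cosetRep j) : i = j := by
  rw [mem_Gamma0_two_iff] at hN
  have hdet := det_entries N
  have hp : ¬ 2 ∣ N 0 0 := by
    rintro ⟨k, hk⟩
    obtain ⟨l, hl⟩ := hN
    have : 2 * (k * N 1 1 - N 0 1 * l) = 1 := by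
      rw [hk, hl] at hdet; linarith
    omega
  have key (k : Fin 2) : 2 ∣ (cosetRep i * N) k 0 - cosetRep j k 0 := by
    rcases h with h | h <;> rw [h]
    · simp
    · exact ⟨-cosetRep j k 0, by simp; ring⟩
  have k₀ := key 0
  have k₁ := key 1
  fin_cases i <;> fin_cases j <;>
    simp [cosetRep, Matrix.mul_apply, Fin.sum_univ_two] at k₀ k₁ ⊢ <;> omega

theorem card_classes_Gamma0_of_emod_eight {Δ : ℤ} (hΔ : Δ % 8 = 5) (hlt : Δ < -4) :
    Nat.card (Classes (Gamma0 2) (OddAdmissible Δ)) =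
      Nat.card (Classes ⊤ (Admissible Δ)) * 3 := by
  let φ : Classes ⊤ (Admissible Δ) × Fin 3 → Classes (Gamma0 2) (OddAdmissible Δ) := fun x =>
    ⟦⟨x.1.out.1.act (cosetRep x.2), x.1.out.2.act _,
      (odd_ac_of_emod_eight hΔ (x.1.out.2.act _).1).1⟩⟧
  have hφ : Function.Bijective φ := by
    constructor
    · rintro ⟨C, i⟩ ⟨D, j⟩ e
      obtain ⟨N, hN, e⟩ := Quotient.exact e
      simp only at e
      rw [← act_mul] at e
      have hCD : C = D := by
        rw [← C.out_eq, ← D.out_eq]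
        refine Quotient.sound ⟨cosetRep i * N * (cosetRep j)⁻¹, trivial, ?_⟩
        rw [act_mul, ← e, ← act_mul, mul_inv_cancel, act_one]
      subst hCD
      have hfix : C.out.1.act (cosetRep i * N * (cosetRep j)⁻¹) = C.out.1 := by
        rw [act_mul, ← e, ← act_mul, mul_inv_cancel, act_one]
      have hij : i = j := by
        refine cosetRep_eq_of_mul hN ?_
        refine (eq_one_or_neg_one_of_act_eq hlt C.out.2 hfix).imp mul_inv_eq_one.mp fun h => ?_
        rw [mul_inv_eq_iff_eq_mul] at h
        rw [h, neg_one_mul]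
      rw [hij]
    · rintro ⟨f⟩
      obtain ⟨M, -, e⟩ : (orbitSetoid ⊤ (Admissible Δ)) (⟦⟨f.1, f.2.1⟩⟧ : Classes _ _).out _ :=
        Quotient.mk_out (s := orbitSetoid ⊤ (Admissible Δ)) ⟨f.1, f.2.1⟩
      obtain ⟨i, N, hN, rfl⟩ := exists_cosetRep_mul M
      refine ⟨(⟦⟨f.1, f.2.1⟩⟧, i), Quotient.sound ⟨N, hN, ?_⟩⟩
      rw [← act_mul]
      exact e
  rw [← Nat.card_congr (_root_.Equiv.ofBijective φ hφ), Nat.card_prod]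
  simp

end ModernForm

namespace ClassicalForm

open ModernForm

/-- The form `(a, 2b, c)` as a modern form. -/
def toModern (f : ClassicalForm) : ModernForm := ⟨f.a, 2 * f.b, f.c⟩

theorem disc_toModern (f : ClassicalForm) : f.toModern.disc = 4 * f.det := by
  simp only [toModern, disc, det]; ring

theorem primitive_and_uneven_iff (f : ClassicalForm) :
    f.Primitive ∧ f.Uneven ↔ f.toModern.Primitive := by
  constructor
  · rintro ⟨h₁, h₂⟩
    exact h₂.trans h₁
  · intro h
    have h₁ : f.divisor = 1 := by
      have h' := (primitive_iff_forall_dvd _).mp h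
      refine (primitive_iff_forall_dvd ⟨f.a, f.b, f.c⟩).mpr fun d ha hb hc => ?_
      exact h' d ha (hb.mul_left 2) hc
    exact ⟨h₁, Eq.trans h h₁.symm⟩

theorem admissible_toModern_iff (f : ClassicalForm) (D : ℤ) :
    Admissible (4 * D) f.toModern ↔ f.det = D ∧ f.PosDef ∧ f.Primitive ∧ f.Uneven := by
  rw [primitive_and_uneven_iff]
  refine and_congr ?_ (and_congr (and_congr ?_ Iff.rfl) Iff.rfl) <;> rw [disc_toModern] <;> omega

end ClassicalForm

open ModernForm ClassicalForm

theorem Ftil_eq_h (n : ℕ) : Ftil n = h (4 * -(n : ℤ)) := by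
  let e : {f : ClassicalForm | f.det = -(n : ℤ) ∧ f.PosDef ∧ f.Primitive ∧ f.Uneven} ≃
      {f // Admissible (4 * -(n : ℤ)) f} :=
    _root_.Equiv.ofBijective
      (fun f => ⟨f.1.toModern, (admissible_toModern_iff f.1 _).mpr f.2⟩) <| by
        constructor
        · rintro ⟨⟨a, b, c⟩, hf⟩ ⟨⟨a', b', c'⟩, hg⟩ e
          simp [toModern] at e
          simp [e]
        · rintro ⟨f, hf⟩
          have h₁ : f.b ^ 2 - 4 * f.a * f.c = 4 * -(n : ℤ) := hf.1
          obtain ⟨b, hb⟩ : 2 ∣ f.b :=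
            Int.prime_two.dvd_of_dvd_pow (n := 2) ⟨2 * -n + 2 * f.a * f.c, by linarith⟩
          have hfb : toModern ⟨f.a, b, f.c⟩ = f := by ext <;> simp [toModern, hb]
          exact ⟨⟨⟨f.a, b, f.c⟩, (admissible_toModern_iff _ _).mp (by rwa [hfb])⟩,
            Subtype.ext hfb⟩
  exact Nat.card_congr (Quot.congr e fun f g => Iff.rfl)

/-- with `n = -Δ/4` if `Δ ≡ 0 (mod 4)` and `n = -Δ` if
`Δ ≡ 1 (mod 4)`, we have `h(Δ) = F̃(n)` when `Δ ≡ 0, 1, 4 (mod 8)` or `Δ = -3`,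
and `h(Δ) = F̃(n)/3` when `Δ ≡ 5 (mod 8)` and `Δ ≠ -3`. -/
theorem h_eq_Ftil (Δ : ℤ) (hneg : Δ < 0) (hmod : Δ % 4 = 0 ∨ Δ % 4 = 1)
    (n : ℕ) (hn : (n : ℤ) = if Δ % 4 = 0 then -Δ / 4 else -Δ) :
    ((Δ % 8 = 0 ∨ Δ % 8 = 1 ∨ Δ % 8 = 4 ∨ Δ = -3) → h Δ = Ftil n) ∧
    ((Δ % 8 = 5 ∧ Δ ≠ -3) → (h Δ : ℚ) = (Ftil n : ℚ) / 3) := by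
  rcases hmod with h0 | h1
  · rw [if_pos h0] at hn
    have hF : h Δ = Ftil n := by
      rw [Ftil_eq_h]
      congr 1
      omega
    exact ⟨fun _ => hF, fun h5 => by omega⟩
  · rw [if_neg (by omega)] at hn
    have hF : Ftil n = Nat.card (Classes (Gamma0 2) (OddAdmissible Δ)) := by
      rw [card_classes_four_mul h1, ← h_eq_card_classes, Ftil_eq_h, hn, neg_neg]
    rw [hF, h_eq_card_classes]
    constructor
    · intro hΔ
      refine (card_classes_Gamma0_eq fun f g hf hg M e => ?_).symm
      by_cases h3 : Δ = -3
      · obtain ⟨N, hN, e'⟩ := exists_Gamma0_act_of_disc_neg_three (hf.1.1.trans h3) M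
        exact ⟨N, hN, e.trans e'⟩
      · exact ⟨M, mem_Gamma0_of_act_odd (by omega) hf.1.1 hf.2 (e ▸ hg.2), e⟩
    · rintro ⟨h5, h3⟩
      rw [card_classes_Gamma0_of_emod_eight h5 (by omega)]
      push_cast
      ring
end

section
/- Let n > 3 be a squarefree integer with n ≡ 3 (mod 8). Then F̃(n) − F̃₁(n) = 2 h(−n). -/
open scoped Classical

theorem ClassicalForm.equiv_equivalence : Equivalence ClassicalForm.Equiv where
  refl f := ⟨1, 0, 0, 1, by norm_num, fun x y => by simp⟩
  symm := by
    rintro f g ⟨p, q, r, s, hdet, hfg⟩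
    refine ⟨s, -q, -r, p, by linear_combination hdet, fun x y => ?_⟩
    rw [hfg]
    congr 1
    · linear_combination (-x) * hdet
    · linear_combination (-y) * hdet
  trans := by
    rintro f g k ⟨p, q, r, s, hdet, hfg⟩ ⟨p', q', r', s', hdet', hgk⟩
    refine ⟨p * p' + q * r', p * q' + q * s', r * p' + s * r', r * q' + s * s',
      by linear_combination (p' * s' - q' * r') * hdet + hdet', fun x y => ?_⟩
    rw [hgk, hfg]
    congr 1 <;> ring

theorem ModernForm.equiv_equivalence : Equivalence ModernForm.Equiv where
  refl f := ⟨1, 0, 0, 1, by norm_num, fun x y => by simp⟩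
  symm := by
    rintro f g ⟨p, q, r, s, hdet, hfg⟩
    refine ⟨s, -q, -r, p, by linear_combination hdet, fun x y => ?_⟩
    rw [hfg]
    congr 1
    · linear_combination (-x) * hdet
    · linear_combination (-y) * hdet
  trans := by
    rintro f g k ⟨p, q, r, s, hdet, hfg⟩ ⟨p', q', r', s', hdet', hgk⟩
    refine ⟨p * p' + q * r', p * q' + q * s', r * p' + s * r', r * q' + s * s',
      by linear_combination (p' * s' - q' * r') * hdet + hdet', fun x y => ?_⟩
    rw [hgk, hfg]
    congr 1 <;> ring

/-- If every common divisor of `a`, `b`, `c` has square dividing a squarefree number, then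
`gcd(a, b, c) = 1`. -/
theorem gcd_gcd_eq_one_of_squarefree {n : ℕ} (hsf : Squarefree n) {a b c : ℤ}
    (hdvd : ∀ d : ℤ, d ∣ a → d ∣ b → d ∣ c → d * d ∣ (n : ℤ)) :
    Int.gcd (Int.gcd a b) c = 1 := by
  set g := Int.gcd (Int.gcd a b) c
  have hab : (g : ℤ) ∣ (Int.gcd a b : ℤ) := Int.gcd_dvd_left _ _
  have hsq := hdvd g (hab.trans (Int.gcd_dvd_left _ _)) (hab.trans (Int.gcd_dvd_right _ _))
    (Int.gcd_dvd_right _ _)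
  exact Nat.isUnit_iff.mp (hsf g (by exact_mod_cast hsq))

theorem exists_bezout_of_gcd_gcd_eq_one {a b c : ℤ} (hgcd : Int.gcd (Int.gcd a b) c = 1) :
    ∃ u v w : ℤ, a * u + b * v + c * w = 1 := by
  have h₁ := Int.gcd_eq_gcd_ab a b
  have h₂ := Int.gcd_eq_gcd_ab (Int.gcd a b) c
  rw [hgcd] at h₂
  push_cast at h₂
  exact ⟨Int.gcdA a b * Int.gcdA (Int.gcd a b) c, Int.gcdB a b * Int.gcdA (Int.gcd a b) c,
    Int.gcdB (Int.gcd a b) c, by linear_combination (-Int.gcdA (Int.gcd a b) c) * h₁ - h₂⟩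

namespace ClassicalForm

theorem primitive_of_det_squarefree {n : ℕ} (hsf : Squarefree n)
    {f : ClassicalForm} (hf : f.det = -(n : ℤ)) : f.Primitive := by
  refine gcd_gcd_eq_one_of_squarefree hsf fun d ha hb hc => ?_
  rw [← dvd_neg, ← hf, det, sq]
  exact dvd_sub (mul_dvd_mul hb hb) (mul_dvd_mul ha hc)

theorem two_dvd_gcd_iff (f : ClassicalForm) :
    2 ∣ Int.gcd (Int.gcd f.a (2 * f.b)) f.c ↔ 2 ∣ f.a ∧ 2 ∣ f.c := by
  simp [Int.dvd_gcd_iff, Int.dvd_coe_gcd_iff]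

theorem Primitive.gcd_eq_one_or_two {f : ClassicalForm} (hf : f.Primitive) :
    Int.gcd (Int.gcd f.a (2 * f.b)) f.c = 1 ∨ Int.gcd (Int.gcd f.a (2 * f.b)) f.c = 2 := by
  obtain ⟨u, v, w, huvw⟩ := exists_bezout_of_gcd_gcd_eq_one hf
  rw [← Nat.dvd_prime Nat.prime_two]
  set g := Int.gcd (Int.gcd f.a (2 * f.b)) f.c
  have hab : (g : ℤ) ∣ (Int.gcd f.a (2 * f.b) : ℤ) := Int.gcd_dvd_left _ _
  have ha : (g : ℤ) ∣ f.a := hab.trans (Int.gcd_dvd_left _ _)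
  have hb : (g : ℤ) ∣ 2 * f.b := hab.trans (Int.gcd_dvd_right _ _)
  have hc : (g : ℤ) ∣ f.c := Int.gcd_dvd_right _ _
  have h2 : (g : ℤ) ∣ f.a * (2 * u) + 2 * f.b * v + f.c * (2 * w) :=
    dvd_add (dvd_add (ha.mul_right _) (hb.mul_right _)) (hc.mul_right _)
  rw [show f.a * (2 * u) + 2 * f.b * v + f.c * (2 * w) = 2 by linear_combination 2 * huvw] at h2
  exact_mod_cast h2

theorem Primitive.uneven_iff {f : ClassicalForm} (hf : f.Primitive) :
    f.Uneven ↔ ¬(2 ∣ f.a ∧ 2 ∣ f.c) := by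
  have h1 : f.divisor = 1 := hf
  rw [← two_dvd_gcd_iff, Uneven, h1]
  rcases hf.gcd_eq_one_or_two with h | h <;> simp [h]

theorem Primitive.evenForm_iff {f : ClassicalForm} (hf : f.Primitive) :
    f.EvenForm ↔ 2 ∣ f.a ∧ 2 ∣ f.c := by
  have h1 : f.divisor = 1 := hf
  rw [← two_dvd_gcd_iff, EvenForm, h1]
  rcases hf.gcd_eq_one_or_two with h | h <;> simp [h]

/-- For squarefree `n > 0`, the defining conditions of the forms counted by `Ftil n`. -/
theorem mem_uneven_iff {n : ℕ} (hn : 0 < n) (hsf : Squarefree n) {f : ClassicalForm} :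
    (f.det = -(n : ℤ) ∧ f.PosDef ∧ f.Primitive ∧ f.Uneven) ↔
      f.det = -(n : ℤ) ∧ 0 < f.a ∧ ¬(2 ∣ f.a ∧ 2 ∣ f.c) := by
  refine and_congr_right fun hdet => ?_
  have hprim := primitive_of_det_squarefree hsf hdet
  rw [hprim.uneven_iff, PosDef, hdet]
  have : -(n : ℤ) < 0 := by omega
  tauto

/-- For squarefree `n > 0`, the defining conditions of the forms counted by `Ftil₁ n`. -/
theorem mem_even_iff {n : ℕ} (hn : 0 < n) (hsf : Squarefree n) {f : ClassicalForm} :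
    (f.det = -(n : ℤ) ∧ f.PosDef ∧ f.Primitive ∧ f.EvenForm) ↔
      f.det = -(n : ℤ) ∧ 0 < f.a ∧ 2 ∣ f.a ∧ 2 ∣ f.c := by
  refine and_congr_right fun hdet => ?_
  have hprim := primitive_of_det_squarefree hsf hdet
  rw [hprim.evenForm_iff, PosDef, hdet]
  have : -(n : ℤ) < 0 := by omega
  tauto

end ClassicalForm

namespace ModernForm

theorem primitive_of_disc_squarefree {n : ℕ} (hsf : Squarefree n)
    {f : ModernForm} (hf : f.disc = -(n : ℤ)) : f.Primitive := by
  refine gcd_gcd_eq_one_of_squarefree hsf fun d ha hb hc => ?_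
  rw [← dvd_neg, ← hf, disc, sq]
  exact dvd_sub (mul_dvd_mul hb hb) (mul_dvd_mul (ha.mul_left 4) hc)

/-- For squarefree `n > 0`, the defining conditions of the forms counted by `h (-n)`. -/
theorem mem_primitive_iff {n : ℕ} (hn : 0 < n) (hsf : Squarefree n) {f : ModernForm} :
    (f.disc = -(n : ℤ) ∧ f.PosDef ∧ f.Primitive) ↔ f.disc = -(n : ℤ) ∧ 0 < f.a := by
  refine and_congr_right fun hdisc => ?_
  have hprim := primitive_of_disc_squarefree hsf hdisc
  rw [PosDef, hdisc]
  have : -(n : ℤ) < 0 := by omega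
  tauto

/-- The coefficients of a form of discriminant `≡ 5 (mod 8)` are odd. -/
theorem odd_coeffs {n : ℕ} (hmod : n % 8 = 3) {f : ModernForm} (hf : f.disc = -(n : ℤ)) :
    f.a % 2 = 1 ∧ f.b % 2 = 1 ∧ f.c % 2 = 1 := by
  unfold disc at hf
  have hb : f.b % 2 = 1 := by
    rcases Int.emod_two_eq_zero_or_one f.b with hb | hb
    · obtain ⟨k, hk⟩ := Int.dvd_of_emod_eq_zero hb
      rw [hk] at hf
      ring_nf at hf
      omega
    · exact hb
  have hsq := Int.eight_dvd_sq_sub_one_of_odd (Int.odd_iff.mpr hb)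
  have hac : (f.a * f.c) % 2 = 1 := by
    rw [mul_assoc] at hf
    omega
  have hodd := Int.odd_mul.mp (Int.odd_iff.mpr hac)
  exact ⟨Int.odd_iff.mp hodd.1, hb, Int.odd_iff.mp hodd.2⟩

/-- A form with odd coefficients takes even values only at points with even coordinates. -/
theorem even_of_eval_even {f : ModernForm} (ha : f.a % 2 = 1) (hb : f.b % 2 = 1)
    (hc : f.c % 2 = 1) {x y : ℤ} (hxy : f.eval x y % 2 = 0) : 2 ∣ x ∧ 2 ∣ y := by
  rw [← Int.even_iff] at hxy
  rw [← Int.odd_iff] at ha hb hc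
  rw [← even_iff_two_dvd, ← even_iff_two_dvd]
  rw [← Int.not_even_iff_odd] at ha hb hc
  simp only [eval, Int.even_add, Int.even_mul, Int.even_pow, ha, hb, hc] at hxy
  simp at hxy
  tauto

theorem ext_eval {f g : ModernForm} (hfg : ∀ x y, f.eval x y = g.eval x y) : f = g := by
  have h₁ := hfg 1 0
  have h₂ := hfg 0 1
  have h₃ := hfg 1 1
  simp only [eval] at h₁ h₂ h₃
  cases f
  cases g
  simp only [mk.injEq]
  refine ⟨?_, ?_, ?_⟩ <;> linarith

/-- A primitive form of discriminant `< -4` has only the proper automorphs `±1`. -/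
theorem Primitive.automorph_eq {n : ℕ} (hn : 4 < n) {f : ModernForm} (hprim : f.Primitive)
    (hdisc : f.disc = -(n : ℤ)) {p q r s : ℤ} (hdet : p * s - q * r = 1)
    (hf : ∀ x y, f.eval x y = f.eval (p * x + q * y) (r * x + s * y)) :
    (p = 1 ∧ q = 0 ∧ r = 0 ∧ s = 1) ∨ (p = -1 ∧ q = 0 ∧ r = 0 ∧ s = -1) := by
  have hA := hf 1 0
  have hC := hf 0 1
  have hB := hf 1 1
  simp only [eval] at hA hB hC
  ring_nf at hA hB hC
  have hB' : f.b = 2 * f.a * p * q + f.b * (p * s + q * r) + 2 * f.c * r * s := by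
    linear_combination hB - hA - hC
  have e₁ : f.a * (s - p) = f.b * r := by
    have : 2 * (f.a * (s - p)) = 2 * (f.b * r) := by
      linear_combination 2 * s * hA - r * hB' + (2 * f.a * p + f.b * r) * hdet
    omega
  have e₂ : f.a * q = -(f.c * r) := by
    have : 2 * (f.a * q) = 2 * -(f.c * r) := by
      linear_combination -s * hB' + 2 * r * hC - (2 * f.a * q + f.b * s) * hdet
    omega
  obtain ⟨u, v, w, huvw⟩ := exists_bezout_of_gcd_gcd_eq_one hprim
  obtain ⟨t, hr⟩ : ∃ t, r = f.a * t :=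
    ⟨r * u + (s - p) * v - q * w, by linear_combination (-r) * huvw - v * e₁ + w * e₂⟩
  unfold disc at hdisc
  have ha : f.a ≠ 0 := by
    intro ha
    rw [ha] at hdisc
    nlinarith [sq_nonneg f.b]
  have hq : q = -(f.c * t) := mul_left_cancel₀ ha (by rw [e₂, hr]; ring)
  have hs : s - p = f.b * t := mul_left_cancel₀ ha (by rw [e₁, hr]; ring)
  have hpell : (p + s) ^ 2 + n * t ^ 2 = 4 := by
    rw [hq, hr] at hdet
    linear_combination 4 * hdet + (s - p + f.b * t) * hs + t ^ 2 * hdisc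
  have ht : t = 0 := by
    by_contra ht
    have : 0 < t ^ 2 := by positivity
    have : (4 : ℤ) < n := by exact_mod_cast hn
    nlinarith [sq_nonneg (p + s)]
  subst ht
  rw [mul_zero] at hr hs
  rw [mul_zero, neg_zero] at hq
  subst hr hq
  have hsp : s = p := by linarith
  subst hsp
  have hs2 : s * s = 1 := by linarith
  rcases mul_self_eq_one_iff.mp hs2 with rfl | rfl <;> simp

/-- Two restrictions of odd forms to index-two sublattices agree only if the change of basis
between the sublattices is induced by an integral change of variables. -/
theorem exists_transform_of_restrict_eq {f g : ModernForm}
    (hfa : f.a % 2 = 1) (hfb : f.b % 2 = 1) (hfc : f.c % 2 = 1)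
    {k₁ k₂ k₃ k₄ l₁ l₂ l₃ l₄ : ℤ} (hk : k₁ * k₄ - k₂ * k₃ = 2) (hl : l₁ * l₄ - l₂ * l₃ = 2)
    (hfg : ∀ x y, g.eval (l₁ * x + l₂ * y) (l₃ * x + l₄ * y) =
      f.eval (k₁ * x + k₂ * y) (k₃ * x + k₄ * y)) :
    ∃ p q r s : ℤ, p * s - q * r = 1 ∧
      (k₁ = p * l₁ + q * l₃ ∧ k₂ = p * l₂ + q * l₄ ∧
        k₃ = r * l₁ + s * l₃ ∧ k₄ = r * l₂ + s * l₄) ∧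
      ∀ x y, g.eval x y = f.eval (p * x + q * y) (r * x + s * y) := by
  have h₁ : f.eval (k₁ * l₄ + k₂ * -l₃) (k₃ * l₄ + k₄ * -l₃) % 2 = 0 := by
    rw [← hfg, show l₁ * l₄ + l₂ * -l₃ = 2 by linarith, show l₃ * l₄ + l₄ * -l₃ = 0 by ring]
    simp only [eval]
    ring_nf
    omega
  have h₂ : f.eval (k₁ * -l₂ + k₂ * l₁) (k₃ * -l₂ + k₄ * l₁) % 2 = 0 := by
    rw [← hfg, show l₁ * -l₂ + l₂ * l₁ = 0 by ring, show l₃ * -l₂ + l₄ * l₁ = 2 by linarith]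
    simp only [eval]
    ring_nf
    omega
  obtain ⟨⟨p, hp⟩, r, hr⟩ := even_of_eval_even hfa hfb hfc h₁
  obtain ⟨⟨q, hq⟩, s, hs⟩ := even_of_eval_even hfa hfb hfc h₂
  have hdet : 4 * (p * s - q * r) = 4 * 1 := by
    have : 4 * (p * s - q * r) = 2 * p * (2 * s) - 2 * q * (2 * r) := by ring
    rw [this, ← hp, ← hq, ← hr, ← hs]
    linear_combination (l₁ * l₄ - l₂ * l₃) * hk + 2 * hl
  refine ⟨p, q, r, s, by omega, ⟨?_, ?_, ?_, ?_⟩, fun x y => ?_⟩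
  · have : 2 * k₁ = 2 * (p * l₁ + q * l₃) := by
      linear_combination l₁ * hp + l₃ * hq - k₁ * hl
    omega
  · have : 2 * k₂ = 2 * (p * l₂ + q * l₄) := by
      linear_combination l₂ * hp + l₄ * hq - k₂ * hl
    omega
  · have : 2 * k₃ = 2 * (r * l₁ + s * l₃) := by
      linear_combination l₁ * hr + l₃ * hs - k₃ * hl
    omega
  · have : 2 * k₄ = 2 * (r * l₂ + s * l₄) := by
      linear_combination l₂ * hr + l₄ * hs - k₄ * hl
    omega
  · have eval_double : ∀ (F : ModernForm) (x y : ℤ), F.eval (2 * x) (2 * y) = 4 * F.eval x y := by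
      intro F x y
      simp only [eval]
      ring
    have key := hfg (l₄ * x - l₂ * y) (-l₃ * x + l₁ * y)
    rw [show l₁ * (l₄ * x - l₂ * y) + l₂ * (-l₃ * x + l₁ * y) = 2 * x by
        linear_combination x * hl,
      show l₃ * (l₄ * x - l₂ * y) + l₄ * (-l₃ * x + l₁ * y) = 2 * y by
        linear_combination y * hl,
      show k₁ * (l₄ * x - l₂ * y) + k₂ * (-l₃ * x + l₁ * y) = 2 * (p * x + q * y) by
        linear_combination x * hp + y * hq,
      show k₃ * (l₄ * x - l₂ * y) + k₄ * (-l₃ * x + l₁ * y) = 2 * (r * x + s * y) by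
        linear_combination x * hr + y * hs, eval_double, eval_double] at key
    omega

/-- Bases, as columns, of the three sublattices of index two in `ℤ²`. -/
def sublatticeBasis (i : Fin 3) : Matrix (Fin 2) (Fin 2) ℤ :=
  ![!![2, 0; 0, 1], !![1, 0; 0, 2], !![1, -1; 1, 1]] i

theorem sublatticeBasis_det (i : Fin 3) :
    sublatticeBasis i 0 0 * sublatticeBasis i 1 1 -
      sublatticeBasis i 0 1 * sublatticeBasis i 1 0 = 2 := by
  fin_cases i <;> simp [sublatticeBasis]

/-- The restriction of a modern form to one of the three sublattices of index two. -/
def restrict (f : ModernForm) (i : Fin 3) : ClassicalForm :=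
  ![⟨4 * f.a, f.b, f.c⟩, ⟨f.a, f.b, 4 * f.c⟩, ⟨f.a + f.b + f.c, f.c - f.a, f.a - f.b + f.c⟩] i

theorem restrict_eval (f : ModernForm) (i : Fin 3) (x y : ℤ) :
    (f.restrict i).eval x y =
      f.eval (sublatticeBasis i 0 0 * x + sublatticeBasis i 0 1 * y)
        (sublatticeBasis i 1 0 * x + sublatticeBasis i 1 1 * y) := by
  fin_cases i <;> simp [restrict, sublatticeBasis, eval, ClassicalForm.eval] <;> ring

theorem restrict_det (f : ModernForm) (i : Fin 3) : (f.restrict i).det = f.disc := by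
  fin_cases i <;> simp [restrict, disc, ClassicalForm.det] <;> ring

theorem restrict_mem {n : ℕ} (hmod : n % 8 = 3) {f : ModernForm} (hdisc : f.disc = -(n : ℤ))
    (hpos : 0 < f.a) (i : Fin 3) :
    (f.restrict i).det = -(n : ℤ) ∧ 0 < (f.restrict i).a ∧
      ¬(2 ∣ (f.restrict i).a ∧ 2 ∣ (f.restrict i).c) := by
  obtain ⟨ha, hb, hc⟩ := odd_coeffs hmod hdisc
  refine ⟨(f.restrict_det i).trans hdisc, ?_⟩
  have hsum : 0 < f.a + f.b + f.c := by
    unfold disc at hdisc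
    have hn : (0 : ℤ) < n := by omega
    have : 0 < 4 * f.a * (f.a + f.b + f.c) := by nlinarith [sq_nonneg (2 * f.a + f.b)]
    exact pos_of_mul_pos_right this (by positivity)
  fin_cases i <;> simp [restrict] <;> omega

/-- An integral basis of determinant two spans one of the three sublattices of index two. -/
theorem exists_eq_sublatticeBasis_mul {k₁ k₂ k₃ k₄ : ℤ} (hk : k₁ * k₄ - k₂ * k₃ = 2) :
    ∃ (i : Fin 3) (p q r s : ℤ), p * s - q * r = 1 ∧
      k₁ = sublatticeBasis i 0 0 * p + sublatticeBasis i 0 1 * r ∧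
      k₂ = sublatticeBasis i 0 0 * q + sublatticeBasis i 0 1 * s ∧
      k₃ = sublatticeBasis i 1 0 * p + sublatticeBasis i 1 1 * r ∧
      k₄ = sublatticeBasis i 1 0 * q + sublatticeBasis i 1 1 * s := by
  have heven : Even (k₁ * k₄ - k₂ * k₃) := by rw [hk]; exact even_two
  have hcases : (2 ∣ k₁ ∧ 2 ∣ k₂) ∨ (2 ∣ k₃ ∧ 2 ∣ k₄) ∨ (2 ∣ k₁ + k₃ ∧ 2 ∣ k₂ + k₄) := by
    simp only [← even_iff_two_dvd]
    simp only [Int.even_sub, Int.even_mul] at heven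
    simp only [Int.even_add]
    tauto
  rcases hcases with ⟨⟨p, hp⟩, q, hq⟩ | ⟨⟨r, hr⟩, s, hs⟩ | ⟨⟨p, hp⟩, q, hq⟩
  · refine ⟨0, p, q, k₃, k₄, ?_, ?_⟩
    · rw [hp, hq] at hk
      linarith
    · simp [sublatticeBasis, hp, hq]
  · refine ⟨1, k₁, k₂, r, s, ?_, ?_⟩
    · rw [hr, hs] at hk
      linarith
    · simp [sublatticeBasis, hr, hs]
  · refine ⟨2, p, q, p - k₁, q - k₂, ?_, ?_⟩
    · rw [show k₃ = 2 * p - k₁ by omega, show k₄ = 2 * q - k₂ by omega] at hk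
      linarith
    · simp [sublatticeBasis]
      omega

/-- An equivalence between restrictions to index-two sublattices extends to `ℤ²`. -/
theorem exists_transform_of_restrict_equiv {f g : ModernForm}
    (ha : f.a % 2 = 1) (hb : f.b % 2 = 1) (hc : f.c % 2 = 1) {i j : Fin 3}
    (hfg : (f.restrict i).Equiv (g.restrict j)) :
    ∃ p q r s p' q' r' s' : ℤ, p * s - q * r = 1 ∧
      (sublatticeBasis i * !![p', q'; r', s'] = !![p, q; r, s] * sublatticeBasis j) ∧
      ∀ x y, g.eval x y = f.eval (p * x + q * y) (r * x + s * y) := by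
  obtain ⟨p', q', r', s', hdet', heval⟩ := hfg
  simp only [restrict_eval] at heval
  have hi := sublatticeBasis_det i
  obtain ⟨p, q, r, s, hdet, ⟨h₁, h₂, h₃, h₄⟩, hfg⟩ := exists_transform_of_restrict_eq
    (g := g) ha hb hc
    (k₁ := sublatticeBasis i 0 0 * p' + sublatticeBasis i 0 1 * r')
    (k₂ := sublatticeBasis i 0 0 * q' + sublatticeBasis i 0 1 * s')
    (k₃ := sublatticeBasis i 1 0 * p' + sublatticeBasis i 1 1 * r')
    (k₄ := sublatticeBasis i 1 0 * q' + sublatticeBasis i 1 1 * s')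
    (by linear_combination (p' * s' - q' * r') * hi + 2 * hdet')
    (sublatticeBasis_det j)
    (fun x y => by rw [heval]; congr 1 <;> ring)
  refine ⟨p, q, r, s, p', q', r', s', hdet, ?_, hfg⟩
  ext a b
  fin_cases a <;> fin_cases b <;> simp [Matrix.mul_apply, *]

/-- Restrictions of a form of discriminant `< -4` to distinct sublattices are inequivalent. -/
theorem eq_of_restrict_equiv {n : ℕ} (hn : 4 < n) {f : ModernForm} (hprim : f.Primitive)
    (hdisc : f.disc = -(n : ℤ)) (ha : f.a % 2 = 1) (hb : f.b % 2 = 1) (hc : f.c % 2 = 1)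
    {i j : Fin 3} (h : (f.restrict i).Equiv (f.restrict j)) : i = j := by
  obtain ⟨p, q, r, s, p', q', r', s', hdet, hmat, heval⟩ :=
    exists_transform_of_restrict_equiv ha hb hc h
  have h₀₀ := congrFun (congrFun hmat 0) 0
  have h₀₁ := congrFun (congrFun hmat 0) 1
  have h₁₀ := congrFun (congrFun hmat 1) 0
  have h₁₁ := congrFun (congrFun hmat 1) 1
  clear h hmat
  rcases hprim.automorph_eq hn hdisc hdet heval with ⟨rfl, rfl, rfl, rfl⟩ | ⟨rfl, rfl, rfl, rfl⟩ <;>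
    fin_cases i <;> fin_cases j <;>
    simp [sublatticeBasis, Matrix.mul_apply] at h₀₀ h₀₁ h₁₀ h₁₁ ⊢ <;> omega

/-- Restrictions of equivalent forms to index-two sublattices are equivalent, up to changing the
sublattice. -/
theorem Equiv.exists_restrict_equiv {f g : ModernForm} (hfg : f.Equiv g) (i : Fin 3) :
    ∃ j, (f.restrict j).Equiv (g.restrict i) := by
  obtain ⟨p, q, r, s, hdet, heval⟩ := hfg
  have hi := sublatticeBasis_det i
  obtain ⟨j, p', q', r', s', hdet', h₁, h₂, h₃, h₄⟩ := exists_eq_sublatticeBasis_mul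
    (k₁ := p * sublatticeBasis i 0 0 + q * sublatticeBasis i 1 0)
    (k₂ := p * sublatticeBasis i 0 1 + q * sublatticeBasis i 1 1)
    (k₃ := r * sublatticeBasis i 0 0 + s * sublatticeBasis i 1 0)
    (k₄ := r * sublatticeBasis i 0 1 + s * sublatticeBasis i 1 1)
    (by linear_combination (p * s - q * r) * hi + 2 * hdet)
  refine ⟨j, p', q', r', s', hdet', fun x y => ?_⟩
  rw [restrict_eval, restrict_eval, heval]
  congr 1
  · linear_combination x * h₁ + y * h₂
  · linear_combination x * h₃ + y * h₄

/-- Every form `(a, 2b, c)` with `a`, `c` not both even, of determinant `≡ 5 (mod 8)`, is the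
restriction of a modern form to a sublattice of index two. -/
theorem exists_restrict_eq {n : ℕ} (hmod : n % 8 = 3) {g : ClassicalForm}
    (hdet : g.det = -(n : ℤ)) (hpos : 0 < g.a) (hodd : ¬(2 ∣ g.a ∧ 2 ∣ g.c)) :
    ∃ (f : ModernForm) (i : Fin 3), f.disc = -(n : ℤ) ∧ 0 < f.a ∧ f.restrict i = g := by
  obtain ⟨a, b, c⟩ := g
  simp only [ClassicalForm.det] at hdet hpos hodd
  rcases Int.even_or_odd b with hb | hb
  · obtain ⟨m, rfl⟩ := hb.two_dvd
    have hac : a * c % 4 = 3 := by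
      have : a * c = 4 * m ^ 2 + n := by linear_combination -hdet
      omega
    have hsum : (a + c) % 4 = 0 := by
      rw [Int.mul_emod] at hac
      have h₁ := Int.emod_nonneg a (show (4 : ℤ) ≠ 0 by norm_num)
      have h₂ := Int.emod_lt_of_pos a (show (0 : ℤ) < 4 by norm_num)
      have h₃ := Int.emod_nonneg c (show (4 : ℤ) ≠ 0 by norm_num)
      have h₄ := Int.emod_lt_of_pos c (show (0 : ℤ) < 4 by norm_num)
      rw [Int.add_emod]
      generalize a % 4 = u at *
      generalize c % 4 = v at *
      interval_cases u <;> interval_cases v <;> simp_all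
    obtain ⟨k, hk⟩ := Int.dvd_of_emod_eq_zero hsum
    obtain rfl : c = 4 * k - a := by omega
    have hn : (0 : ℤ) < n := by omega
    refine ⟨⟨k - m, a - 2 * k, k + m⟩, 2, ?_, ?_, ?_⟩
    · simp only [disc]
      linear_combination hdet
    · have : 0 < 4 * a * (k - m) := by nlinarith [sq_nonneg (a - 2 * m)]
      exact pos_of_mul_pos_right this (by positivity)
    · simp [restrict]
      refine ⟨?_, ?_, ?_⟩ <;> ring
  · have hac : 4 ∣ a * c := by
      have := Int.eight_dvd_sq_sub_one_of_odd hb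
      have : a * c = b ^ 2 + n := by linear_combination -hdet
      omega
    rcases Int.even_or_odd a with ha | ha
    · have hc : IsCoprime (4 : ℤ) c := by
        have hc : Odd c := by
          rw [← Int.not_even_iff_odd, even_iff_two_dvd]
          exact fun hc => hodd ⟨ha.two_dvd, hc⟩
        exact (Int.isCoprime_two_left.mpr hc).pow_left (m := 2)
      obtain ⟨k, rfl⟩ := hc.dvd_of_dvd_mul_right hac
      refine ⟨⟨k, b, c⟩, 0, ?_, by simpa using hpos, by simp [restrict]⟩
      simp only [disc]
      exact hdet
    · have ha : IsCoprime (4 : ℤ) a := (Int.isCoprime_two_left.mpr ha).pow_left (m := 2)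
      obtain ⟨k, rfl⟩ := ha.dvd_of_dvd_mul_left hac
      refine ⟨⟨a, b, k⟩, 1, ?_, hpos, by simp [restrict]⟩
      simp only [disc]
      linear_combination hdet

end ModernForm

theorem Ftil_eq_three_mul_h {n : ℕ} (hn : 4 < n) (hsf : Squarefree n) (hmod : n % 8 = 3) :
    Ftil n = h (-(n : ℤ)) * 3 := by
  have hn0 : 0 < n := by omega
  let X := {f : ModernForm // f.disc = -(n : ℤ) ∧ f.PosDef ∧ f.Primitive}
  let Y : Set ClassicalForm := {f | f.det = -(n : ℤ) ∧ f.PosDef ∧ f.Primitive ∧ f.Uneven}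
  let rX : X → X → Prop := fun f g => f.1.Equiv g.1
  let rY : Y → Y → Prop := fun f g => f.1.Equiv g.1
  have hX : Equivalence rX := ModernForm.equiv_equivalence.comap Subtype.val
  have hY : Equivalence rY := ClassicalForm.equiv_equivalence.comap Subtype.val
  have hodd (f : X) := ModernForm.odd_coeffs hmod f.2.1
  let restr (f : X) (i : Fin 3) : Y := ⟨f.1.restrict i,
    (ClassicalForm.mem_uneven_iff hn0 hsf).mpr (ModernForm.restrict_mem hmod f.2.1 f.2.2.1.2 i)⟩
  let φ : Quot rX × Fin 3 → Quot rY := fun z => Quot.mk rY (restr z.1.out z.2)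
  have hφ : Function.Bijective φ := by
    constructor
    · rintro ⟨C, i⟩ ⟨C', j⟩ hij
      have hequiv : (C.out.1.restrict i).Equiv (C'.out.1.restrict j) :=
        (hY.quot_mk_eq_iff _ _).mp hij
      obtain ⟨ha, hb, hc⟩ := hodd C.out
      obtain ⟨p, q, r, s, -, -, -, -, hdet, -, heval⟩ :=
        ModernForm.exists_transform_of_restrict_equiv ha hb hc hequiv
      have hCC' : C = C' := by
        rw [← C.out_eq, ← C'.out_eq]
        exact Quot.sound ⟨p, q, r, s, hdet, heval⟩
      subst hCC'
      rw [ModernForm.eq_of_restrict_equiv hn C.out.2.2.2 C.out.2.1 ha hb hc hequiv]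
    · rintro ⟨g⟩
      obtain ⟨hdet, hpos, huneven⟩ := (ClassicalForm.mem_uneven_iff hn0 hsf).mp g.2
      obtain ⟨f, i, hdisc, hfpos, hfg⟩ := ModernForm.exists_restrict_eq hmod hdet hpos huneven
      let f' : X := ⟨f, (ModernForm.mem_primitive_iff hn0 hsf).mpr ⟨hdisc, hfpos⟩⟩
      have hout : rX (Quot.mk rX f').out f' := (hX.quot_mk_eq_iff _ _).mp (Quot.out_eq _)
      obtain ⟨j, hj⟩ := ModernForm.Equiv.exists_restrict_equiv hout i
      refine ⟨(Quot.mk rX f', j), Quot.sound ?_⟩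
      change ((Quot.mk rX f').out.1.restrict j).Equiv g.1
      rwa [← hfg]
  have hcard := Nat.card_congr (_root_.Equiv.ofBijective φ hφ)
  rw [Nat.card_prod, Nat.card_fin] at hcard
  exact hcard.symm

theorem Ftil₁_eq_h {n : ℕ} (hsf : Squarefree n) (hmod : n % 8 = 3) :
    Ftil₁ n = h (-(n : ℤ)) := by
  have hn0 : 0 < n := by omega
  let X := {f : ModernForm // f.disc = -(n : ℤ) ∧ f.PosDef ∧ f.Primitive}
  let Y : Set ClassicalForm := {f | f.det = -(n : ℤ) ∧ f.PosDef ∧ f.Primitive ∧ f.EvenForm}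
  let double (f : X) : Y := ⟨⟨2 * f.1.a, f.1.b, 2 * f.1.c⟩,
    (ClassicalForm.mem_even_iff hn0 hsf).mpr ⟨by
      have hdisc := f.2.1
      rw [ModernForm.disc] at hdisc
      rw [ClassicalForm.det]
      linear_combination hdisc, by have := f.2.2.1.2; positivity, dvd_mul_right _ _, dvd_mul_right _ _⟩⟩
  have hdouble : Function.Bijective double := by
    constructor
    · rintro ⟨⟨a, b, c⟩, hf⟩ ⟨⟨a', b', c'⟩, hf'⟩ heq
      exact Subtype.ext (by simpa [double] using heq)
    · rintro ⟨⟨a, b, c⟩, hg⟩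
      obtain ⟨hdet, hpos, ⟨a, rfl⟩, ⟨c, rfl⟩⟩ := (ClassicalForm.mem_even_iff hn0 hsf).mp hg
      refine ⟨⟨⟨a, b, c⟩, (ModernForm.mem_primitive_iff hn0 hsf).mpr ⟨?_, by simpa using hpos⟩⟩,
        rfl⟩
      rw [← hdet, ModernForm.disc, ClassicalForm.det]
      ring
  have heval (f : X) (x y : ℤ) : (double f).1.eval x y = 2 * f.1.eval x y := by
    simp only [double, ClassicalForm.eval, ModernForm.eval]
    ring
  refine (Nat.card_congr (Quot.congr (_root_.Equiv.ofBijective double hdouble) fun f g => ?_)).symm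
  simp only [_root_.Equiv.ofBijective_apply, ModernForm.Equiv, ClassicalForm.Equiv, heval,
    mul_right_inj' (two_ne_zero' ℤ)]

/-- for squarefree `n > 3` with `n ≡ 3 (mod 8)`,
`F̃(n) - F̃₁(n) = 2 h(-n)`. -/
theorem Ftil_sub_Ftil₁_eq_two_h (n : ℕ) (hn : 3 < n) (hsf : Squarefree n)
    (hmod : n % 8 = 3) :
    (Ftil n : ℤ) - (Ftil₁ n : ℤ) = 2 * (h (-(n : ℤ)) : ℤ) := by
  have hn4 : 4 < n := by omega
  rw [Ftil_eq_three_mul_h hn4 hsf hmod, Ftil₁_eq_h hsf hmod]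
  push_cast
  ring
end

section
/- For a positive integer n, the equalities F(n) = F̃(n) and F₁(n) = F̃₁(n) both hold if and only if n is squarefree. -/
open scoped Classical

namespace ClassicalForm

/-- An equivalence of forms, expressed through the coefficients. -/
theorem equiv_iff {f g : ClassicalForm} :
    f.Equiv g ↔ ∃ p q r s : ℤ, p * s - q * r = 1 ∧
      g.a = f.a * p ^ 2 + 2 * f.b * p * r + f.c * r ^ 2 ∧
      g.b = f.a * p * q + f.b * (p * s + q * r) + f.c * r * s ∧
      g.c = f.a * q ^ 2 + 2 * f.b * q * s + f.c * s ^ 2 := by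
  constructor
  · rintro ⟨p, q, r, s, h, H⟩
    have h₁ := H 1 0
    have h₂ := H 0 1
    have h₃ := H 1 1
    simp only [eval] at h₁ h₂ h₃
    exact ⟨p, q, r, s, h, by linarith, by linarith, by linarith⟩
  · rintro ⟨p, q, r, s, h, ha, hb, hc⟩
    refine ⟨p, q, r, s, h, fun x y => ?_⟩
    simp only [eval, ha, hb, hc]
    ring

theorem Equiv.refl (f : ClassicalForm) : f.Equiv f :=
  ⟨1, 0, 0, 1, by norm_num, fun x y => by simp⟩

theorem Equiv.symm {f g : ClassicalForm} (h : f.Equiv g) : g.Equiv f := by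
  obtain ⟨p, q, r, s, h, H⟩ := h
  refine ⟨s, -q, -r, p, by linarith, fun x y => ?_⟩
  rw [H]
  congr 1
  · linear_combination (-x) * h
  · linear_combination (-y) * h

theorem Equiv.trans {f g k : ClassicalForm} (h₁ : f.Equiv g) (h₂ : g.Equiv k) : f.Equiv k := by
  obtain ⟨p, q, r, s, h, H⟩ := h₁
  obtain ⟨p', q', r', s', h', H'⟩ := h₂
  refine ⟨p * p' + q * r', p * q' + q * s', r * p' + s * r', r * q' + s * s', ?_, fun x y => ?_⟩
  · linear_combination (p' * s' - q' * r') * h + h'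
  · rw [H', H]
    congr 1 <;> ring

theorem Equiv.det_eq {f g : ClassicalForm} (h : f.Equiv g) : g.det = f.det := by
  obtain ⟨p, q, r, s, h, ha, hb, hc⟩ := equiv_iff.1 h
  simp only [det, ha, hb, hc]
  linear_combination (f.b ^ 2 - f.a * f.c) * (p * s - q * r + 1) * h

theorem Equiv.posDef {f g : ClassicalForm} (h : f.Equiv g) (hf : f.PosDef) : g.PosDef := by
  obtain ⟨hd, hpos⟩ := hf
  refine ⟨by rwa [h.det_eq], ?_⟩
  obtain ⟨p, q, r, s, h, ha, -, -⟩ := equiv_iff.1 h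
  have key : f.a * g.a = (f.a * p + f.b * r) ^ 2 + (-f.det) * r ^ 2 := by
    rw [ha, det]; ring
  refine pos_of_mul_pos_right (a := f.a) ?_ hpos.le
  rw [key]
  rcases eq_or_ne r 0 with rfl | hr
  · have hp : p ≠ 0 := by rintro rfl; simp at h
    have : f.a * p ≠ 0 := mul_ne_zero hpos.ne' hp
    simp only [mul_zero, add_zero, ne_eq, OfNat.ofNat_ne_zero, not_false_eq_true, zero_pow]
    positivity
  · have : 0 < -f.det := by linarith
    positivity

/-- The divisor of a form is invariant under equivalence. -/
theorem Equiv.divisor_eq {f g : ClassicalForm} (h : f.Equiv g) : f.divisor = g.divisor := by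
  suffices H : ∀ {f g : ClassicalForm}, f.Equiv g → f.divisor ∣ g.divisor from
    Nat.dvd_antisymm (H h) (H h.symm)
  intro f g h
  obtain ⟨p, q, r, s, -, ha, hb, hc⟩ := equiv_iff.1 h
  have hfa : (f.divisor : ℤ) ∣ f.a := (Int.gcd_dvd_left ..).trans (Int.gcd_dvd_left ..)
  have hfb : (f.divisor : ℤ) ∣ f.b := (Int.gcd_dvd_left ..).trans (Int.gcd_dvd_right ..)
  have hfc : (f.divisor : ℤ) ∣ f.c := Int.gcd_dvd_right ..
  obtain ⟨u, hu⟩ := hfa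
  obtain ⟨v, hv⟩ := hfb
  obtain ⟨w, hw⟩ := hfc
  generalize f.divisor = d at *
  refine Int.dvd_gcd (Int.dvd_coe_gcd ?_ ?_) ?_
  · rw [ha, hu, hv, hw]
    exact ⟨u * p ^ 2 + 2 * v * p * r + w * r ^ 2, by ring⟩
  · rw [hb, hu, hv, hw]
    exact ⟨u * p * q + v * (p * s + q * r) + w * r * s, by ring⟩
  · rw [hc, hu, hv, hw]
    exact ⟨u * q ^ 2 + 2 * v * q * s + w * s ^ 2, by ring⟩

/-- The quantity `gcd(a, 2b, c)` is invariant under equivalence. -/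
theorem Equiv.gcd_two_mul_eq {f g : ClassicalForm} (h : f.Equiv g) :
    Int.gcd (Int.gcd f.a (2 * f.b)) f.c = Int.gcd (Int.gcd g.a (2 * g.b)) g.c := by
  suffices H : ∀ {f g : ClassicalForm}, f.Equiv g →
      Int.gcd (Int.gcd f.a (2 * f.b)) f.c ∣ Int.gcd (Int.gcd g.a (2 * g.b)) g.c from
    Nat.dvd_antisymm (H h) (H h.symm)
  intro f g h
  obtain ⟨p, q, r, s, -, ha, hb, hc⟩ := equiv_iff.1 h
  have hfa : (Int.gcd (Int.gcd f.a (2 * f.b)) f.c : ℤ) ∣ f.a :=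
    (Int.gcd_dvd_left ..).trans (Int.gcd_dvd_left ..)
  have hfb : (Int.gcd (Int.gcd f.a (2 * f.b)) f.c : ℤ) ∣ 2 * f.b :=
    (Int.gcd_dvd_left ..).trans (Int.gcd_dvd_right ..)
  have hfc : (Int.gcd (Int.gcd f.a (2 * f.b)) f.c : ℤ) ∣ f.c := Int.gcd_dvd_right ..
  generalize Int.gcd (Int.gcd f.a (2 * f.b)) f.c = d at *
  obtain ⟨u, hu⟩ := hfa
  obtain ⟨v, hv⟩ := hfb
  obtain ⟨w, hw⟩ := hfc
  refine Int.dvd_gcd (Int.dvd_coe_gcd ?_ ?_) ?_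
  · rw [ha, hu, hv, hw]
    exact ⟨u * p ^ 2 + v * p * r + w * r ^ 2, by ring⟩
  · refine ⟨2 * u * p * q + v * (p * s + q * r) + 2 * w * r * s, ?_⟩
    rw [hb, hu, hw]
    linear_combination (p * s + q * r) * hv
  · rw [hc, hu, hv, hw]
    exact ⟨u * q ^ 2 + v * q * s + w * s ^ 2, by ring⟩

theorem Equiv.uneven {f g : ClassicalForm} (h : f.Equiv g) (hf : f.Uneven) : g.Uneven := by
  rw [Uneven, ← h.gcd_two_mul_eq, ← h.divisor_eq]
  exact hf

/-- Every positive definite form is equivalent to a form with `|2b| ≤ a ≤ c`. -/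
theorem PosDef.exists_reduced {f : ClassicalForm} (hf : f.PosDef) :
    ∃ g : ClassicalForm, f.Equiv g ∧ |2 * g.b| ≤ g.a ∧ g.a ≤ g.c := by
  induction hk : f.a.toNat using Nat.strong_induction_on generalizing f with
  | _ k ih =>
    have hpos := hf.2
    obtain ⟨t, ht⟩ : ∃ t : ℤ, |2 * (f.b + f.a * t)| ≤ f.a := by
      refine ⟨-((2 * f.b + f.a) / (2 * f.a)), ?_⟩
      have h₁ := Int.emod_add_mul_ediv (2 * f.b + f.a) (2 * f.a)
      have h₂ := Int.emod_nonneg (2 * f.b + f.a) (b := 2 * f.a) (by omega)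
      have h₃ := Int.emod_lt_of_pos (2 * f.b + f.a) (b := 2 * f.a) (by omega)
      rw [abs_le]
      constructor <;> linarith
    set g : ClassicalForm := ⟨f.a, f.b + f.a * t, f.a * t ^ 2 + 2 * f.b * t + f.c⟩ with hg
    have hfg : f.Equiv g := equiv_iff.2 ⟨1, t, 0, 1, by norm_num, by simp [hg],
      by simp only [hg]; ring, by simp only [hg]; ring⟩
    by_cases hac : g.a ≤ g.c
    · exact ⟨g, hfg, ht, hac⟩
    · have hgk : g.Equiv ⟨g.c, -g.b, g.a⟩ :=
        equiv_iff.2 ⟨0, -1, 1, 0, by norm_num, by simp, by simp, by simp⟩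
      have hfk := hfg.trans hgk
      have hkpos := hfk.posDef hf
      obtain ⟨m, hm, hred⟩ := ih g.c.toNat
        (by have h₁ := hkpos.2; have h₂ : g.a = f.a := rfl; simp only at h₁; omega) hkpos rfl
      exact ⟨m, hfk.trans hm, hred⟩

/-- There are finitely many reduced forms of a given determinant. -/
theorem finite_reduced (n : ℤ) :
    {f : ClassicalForm | f.det = -n ∧ f.PosDef ∧ |2 * f.b| ≤ f.a ∧ f.a ≤ f.c}.Finite := by
  refine ((((Set.finite_Icc 0 (2 * n)).prod (Set.finite_Icc (-(2 * n)) (2 * n))).prod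
    (Set.finite_Icc 0 (n + 4 * n ^ 2))).image
      (fun x => (⟨x.1.1, x.1.2, x.2⟩ : ClassicalForm))).subset ?_
  rintro ⟨a, b, c⟩ ⟨hdet, ⟨-, hpos⟩, hb, hac⟩
  simp only [det] at hdet hpos hb hac
  obtain ⟨hb₁, hb₂⟩ := abs_le.1 hb
  have hbsq : 4 * b ^ 2 ≤ a ^ 2 := by nlinarith
  have ha : a ≤ 2 * n := by nlinarith
  have hc : c ≤ n + 4 * n ^ 2 := by nlinarith
  exact ⟨((a, b), c), ⟨⟨⟨hpos.le, ha⟩, ⟨by linarith, by linarith⟩⟩, ⟨by linarith, hc⟩⟩, rfl⟩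

/-- A set of positive definite forms of fixed determinant which is closed under equivalence
consists of finitely many classes. -/
theorem finite_quot {S : Set ClassicalForm} {n : ℤ} (hS : ∀ f ∈ S, f.det = -n ∧ f.PosDef)
    (hcl : ∀ f ∈ S, ∀ g, f.Equiv g → g ∈ S) :
    Finite (Quot (fun f g : S => ClassicalForm.Equiv f.1 g.1)) := by
  have : Finite {f : S // |2 * f.1.b| ≤ f.1.a ∧ f.1.a ≤ f.1.c} := by
    have := (finite_reduced n).to_subtype
    exact Finite.of_injective
      (β := {f : ClassicalForm | f.det = -n ∧ f.PosDef ∧ |2 * f.b| ≤ f.a ∧ f.a ≤ f.c})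
      (fun f => ⟨f.1.1, (hS _ f.1.2).1, (hS _ f.1.2).2, f.2⟩)
      fun f g h => Subtype.ext (Subtype.ext (Subtype.mk.inj h))
  refine Finite.of_surjective (fun f : {f : S // |2 * f.1.b| ≤ f.1.a ∧ f.1.a ≤ f.1.c} =>
    Quot.mk (fun f g : S => ClassicalForm.Equiv f.1 g.1) f.1) fun q => ?_
  induction q using Quot.ind with
  | _ f =>
    obtain ⟨g, hfg, hg⟩ := (hS _ f.2).2.exists_reduced
    exact ⟨⟨⟨g, hcl _ f.2 _ hfg⟩, hg⟩, Quot.sound hfg.symm⟩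

/-- The square of the divisor divides the determinant. -/
theorem divisor_mul_self_dvd_det (f : ClassicalForm) : (f.divisor * f.divisor : ℤ) ∣ f.det := by
  have ha : (f.divisor : ℤ) ∣ f.a := (Int.gcd_dvd_left ..).trans (Int.gcd_dvd_left ..)
  have hb : (f.divisor : ℤ) ∣ f.b := (Int.gcd_dvd_left ..).trans (Int.gcd_dvd_right ..)
  have hc : (f.divisor : ℤ) ∣ f.c := Int.gcd_dvd_right ..
  rw [det, sq]
  exact dvd_sub (mul_dvd_mul hb hb) (mul_dvd_mul ha hc)

theorem primitive_of_squarefree {f : ClassicalForm} {n : ℕ} (hn : Squarefree n)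
    (hf : f.det = -(n : ℤ)) : f.Primitive := by
  have h := f.divisor_mul_self_dvd_det
  rw [hf, dvd_neg] at h
  exact Nat.isUnit_iff.1 (hn _ (by exact_mod_cast h))

end ClassicalForm

/-- Discarding at least one class by an equivalence-invariant condition lowers the class count. -/
theorem classCount_inter_lt {S P : Set ClassicalForm}
    [Finite (Quot (fun f g : S => ClassicalForm.Equiv f.1 g.1))]
    (hP : ∀ f g, ClassicalForm.Equiv f g → (f ∈ P ↔ g ∈ P)) (hne : ∃ f ∈ S, f ∉ P) :
    classCount (S ∩ P) < classCount S := by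
  let φ : Quot (fun f g : S => ClassicalForm.Equiv f.1 g.1) →
      Option (Quot (fun f g : ↥(S ∩ P) => ClassicalForm.Equiv f.1 g.1)) :=
    Quot.lift (fun f => if h : f.1 ∈ P then some (Quot.mk _ ⟨f.1, f.2, h⟩) else none) <| by
      intro f g hfg
      by_cases hf : f.1 ∈ P
      · have hg := (hP _ _ hfg).1 hf
        simp only [hf, hg, dif_pos]
        exact congrArg some (Quot.sound hfg)
      · have hg := mt (hP _ _ hfg).2 hf
        simp only [hf, hg, dif_neg, not_false_eq_true]
  have hφ : Function.Surjective φ := by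
    rintro (_ | q)
    · obtain ⟨f, hf, hfP⟩ := hne
      exact ⟨Quot.mk _ ⟨f, hf⟩, dif_neg hfP⟩
    · induction q using Quot.ind with
      | _ f => exact ⟨Quot.mk _ ⟨f.1, f.2.1⟩, dif_pos f.2.2⟩
  have : Finite (Option (Quot (fun f g : ↥(S ∩ P) => ClassicalForm.Equiv f.1 g.1))) :=
    Finite.of_surjective φ hφ
  have : Finite (Quot (fun f g : ↥(S ∩ P) => ClassicalForm.Equiv f.1 g.1)) :=
    Finite.of_injective some (Option.some_injective _)
  have h := Nat.card_le_card_of_surjective φ hφ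
  rw [Finite.card_option] at h
  exact h

/-- If `n` is not squarefree, some positive definite uneven form of determinant `-n` is derived. -/
theorem Ftil_lt_F_of_not_squarefree {n : ℕ} (hn : 0 < n) (h : ¬ Squarefree n) :
    Ftil n < F n := by
  obtain ⟨t, ⟨m, rfl⟩, ht⟩ : ∃ t, t * t ∣ n ∧ ¬ IsUnit t := by
    simpa [Squarefree] using h
  rw [Nat.isUnit_iff] at ht
  set S : Set ClassicalForm :=
    {f | f.det = -((t * t * m : ℕ) : ℤ) ∧ f.PosDef ∧ f.Uneven} with hS
  have := ClassicalForm.finite_quot (S := S) (fun f hf => ⟨hf.1, hf.2.1⟩)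
    fun f hf g hfg => ⟨hfg.det_eq.trans hf.1, hfg.posDef hf.2.1, hfg.uneven hf.2.2⟩
  have key := classCount_inter_lt (S := S) (P := {f | f.Primitive})
    (fun f g hfg => by simp only [Set.mem_ofPred_eq, ClassicalForm.Primitive, hfg.divisor_eq]) ?_
  · suffices h : S ∩ {f | f.Primitive} = {f | f.det = -((t * t * m : ℕ) : ℤ) ∧ f.PosDef ∧
        f.Primitive ∧ f.Uneven} by
      rwa [h] at key
    ext f
    simp only [hS, Set.mem_inter_iff, Set.mem_ofPred_eq]
    tauto
  · have hdet : (⟨t, 0, t * m⟩ : ClassicalForm).det = -((t * t * m : ℕ) : ℤ) := by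
      simp only [ClassicalForm.det]; push_cast; ring
    have htpos : 0 < t := Nat.pos_of_ne_zero (by rintro rfl; simp at hn)
    refine ⟨⟨t, 0, t * m⟩, ⟨hdet, ⟨by rw [hdet]; omega, Int.natCast_pos.2 htpos⟩, ?_⟩, ?_⟩
    · simp [ClassicalForm.Uneven, ClassicalForm.divisor]
    · simpa [ClassicalForm.Primitive, ClassicalForm.divisor] using ht

/-- `F(n) = F̃(n)` and `F₁(n) = F̃₁(n)` both hold if and only if
`n` is squarefree. -/
theorem F_eq_Ftil_iff_squarefree (n : ℕ) (hn : 0 < n) :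
    (F n = Ftil n ∧ F₁ n = Ftil₁ n) ↔ Squarefree n := by
  refine ⟨fun h => ?_, fun h => ⟨?_, ?_⟩⟩
  · by_contra hsq
    exact (Ftil_lt_F_of_not_squarefree hn hsq).ne' h.1
  · rw [F, Ftil]
    congr 1
    ext f
    exact ⟨fun hf => ⟨hf.1, hf.2.1, ClassicalForm.primitive_of_squarefree h hf.1, hf.2.2⟩,
      fun hf => ⟨hf.1, hf.2.1, hf.2.2.2⟩⟩
  · rw [F₁, Ftil₁]
    congr 1
    ext f
    exact ⟨fun hf => ⟨hf.1, hf.2.1, ClassicalForm.primitive_of_squarefree h hf.1, hf.2.2⟩,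
      fun hf => ⟨hf.1, hf.2.1, hf.2.2.2⟩⟩
end
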